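/- arXiv:1704.03854 — 10 statements merged into one kernel-verified Lean document; each statement's English description precedes it below -/
import Mathlib

section
/- Let t₀ < t₁ be reals, let a : ℝ → ℝ be continuous on [t₀,t₁] with a(t₀) = 0, positive and twice continuously differentiable on (t₀,t₁], let C > 0 and κ ∈ ℝ, and set G(t) = a''(t)/a(t) − a'(t)²/a(t)² − κ/a(t)² and f(t) = 3a''(t) + (2C/a(t))·G(t). Assume: (i) lim_{t→t₀⁺} ∫_t^{t₁} a(s) ∫_s^{t₁} G(u) du ds = −∞, and (ii) lim_{t→t₀⁺} ∫_t^{t₁} max(f(s),0) ds exists and equals a nonnegative real α. If θ : (t₀,t₁] → ℝ is continuously differentiable and satisfies θ'(t) ≤ f(t)/√(C + a(t)²) for all t ∈ (t₀,t₁], then lim_{t→t₀⁺} ∫_t^{t₁} (a(s)/√(C + a(s)²))·θ(s) ds = +∞. -/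
open Filter Topology Set MeasureTheory intervalIntegral

/-- A function continuous on `(t₀, t₁]` is interval integrable on `[s, t₁]` for `t₀ < s ≤ t₁`. -/
lemma intervalIntegrable_of_continuousOn_Ioc {g : ℝ → ℝ} {t₀ t₁ s : ℝ}
    (hg : ContinuousOn g (Ioc t₀ t₁)) (hs : s ∈ Ioc t₀ t₁) :
    IntervalIntegrable g volume s t₁ :=
  ContinuousOn.intervalIntegrable_of_Icc hs.2
    (hg.mono fun _ hu => ⟨hs.1.trans_le hu.1, hu.2⟩)

/-- Monotonicity of `s ↦ ∫ u in s..t₁, g u` in the integrand, for integrands continuous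
on `(t₀, t₁]`. -/
lemma integral_mono_of_continuousOn_Ioc {g h : ℝ → ℝ} {t₀ t₁ s : ℝ}
    (hg : ContinuousOn g (Ioc t₀ t₁)) (hh : ContinuousOn h (Ioc t₀ t₁))
    (hgh : ∀ u ∈ Ioc t₀ t₁, g u ≤ h u) (hs : s ∈ Ioc t₀ t₁) :
    ∫ u in s..t₁, g u ≤ ∫ u in s..t₁, h u :=
  intervalIntegral.integral_mono_on hs.2 (intervalIntegrable_of_continuousOn_Ioc hg hs)
    (intervalIntegrable_of_continuousOn_Ioc hh hs)
    fun u hu => hgh u ⟨hs.1.trans_le hu.1, hu.2⟩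

/-- The fundamental theorem of calculus on `[s, t₁]` for a function continuously
differentiable on `(t₀, t₁]`. -/
lemma integral_eq_sub_of_continuousOn_Ioc {g g' : ℝ → ℝ} {t₀ t₁ s : ℝ}
    (hg : ∀ t ∈ Ioc t₀ t₁, HasDerivAt g (g' t) t) (hg' : ContinuousOn g' (Ioc t₀ t₁))
    (hs : s ∈ Ioc t₀ t₁) : ∫ u in s..t₁, g' u = g t₁ - g s := by
  refine intervalIntegral.integral_eq_sub_of_hasDerivAt (fun u hu => hg u ?_)
    (intervalIntegrable_of_continuousOn_Ioc hg' hs)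
  rw [uIcc_of_le hs.2] at hu
  exact ⟨hs.1.trans_le hu.1, hu.2⟩

/-- The primitive `s ↦ ∫ u in s..t₁, g u` of a function continuous on `(t₀, t₁]` is continuous
on `(t₀, t₁]`. -/
lemma continuousOn_primitive_Ioc {g : ℝ → ℝ} {t₀ t₁ : ℝ} (hg : ContinuousOn g (Ioc t₀ t₁)) :
    ContinuousOn (fun s => ∫ u in s..t₁, g u) (Ioc t₀ t₁) := by
  intro s hs
  obtain ⟨r, hr₀, hrs⟩ := exists_between hs.1
  have hr : r ∈ Ioc t₀ t₁ := ⟨hr₀, hrs.le.trans hs.2⟩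
  have hint := (intervalIntegrable_iff' (by finiteness)).1
    (intervalIntegrable_of_continuousOn_Ioc hg hr)
  have hcont := continuousOn_primitive_interval_left hint
  rw [uIcc_of_le hr.2] at hcont
  refine (hcont s ⟨hrs.le, hs.2⟩).mono_of_mem_nhdsWithin ?_
  filter_upwards [self_mem_nhdsWithin, mem_nhdsWithin_of_mem_nhds (Ioi_mem_nhds hrs)] with u hu hru
  exact ⟨le_of_lt hru, hu.2⟩

/-- If the integrals of a continuous nonnegative function over `[t, t₁]` converge as `t` tends to
`t₀` from the right, then they are bounded by their limit. -/
lemma integral_le_of_tendsto_of_nonneg {g : ℝ → ℝ} {t₀ t₁ α s : ℝ}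
    (hg : ContinuousOn g (Ioc t₀ t₁)) (hg0 : ∀ t, 0 ≤ g t)
    (hlim : Tendsto (fun t => ∫ u in t..t₁, g u) (𝓝[>] t₀) (𝓝 α)) (hs : s ∈ Ioc t₀ t₁) :
    ∫ u in s..t₁, g u ≤ α := by
  refine ge_of_tendsto hlim ?_
  filter_upwards [Ioo_mem_nhdsGT hs.1] with t ht
  have hI := intervalIntegrable_of_continuousOn_Ioc hg ⟨ht.1, ht.2.le.trans hs.2⟩
  exact intervalIntegral.integral_mono_interval ht.2.le hs.2 le_rfl (Eventually.of_forall hg0) hI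

/-- Analytic core of the main theorem for timelike geodesics in a singular FLRW
spacetime: under conditions (33) and (34) of the paper, the Raychaudhuri
inequality for the expansion `θ` forces the integral expressing `log det A` to
diverge, i.e. there is a conjugate point. -/
theorem flrw_timelike_conjugate_core
    (t₀ t₁ : ℝ) (ht : t₀ < t₁)
    (a a' a'' : ℝ → ℝ)
    (ha_cont : ContinuousOn a (Icc t₀ t₁))
    (ha0 : a t₀ = 0)
    (ha_pos : ∀ t ∈ Ioc t₀ t₁, 0 < a t)
    (ha' : ∀ t ∈ Ioc t₀ t₁, HasDerivAt a (a' t) t)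
    (ha'' : ∀ t ∈ Ioc t₀ t₁, HasDerivAt a' (a'' t) t)
    (ha''_cont : ContinuousOn a'' (Ioc t₀ t₁))
    (C κ : ℝ) (hC : 0 < C)
    (G f : ℝ → ℝ)
    (hG : ∀ t, G t = a'' t / a t - (a' t) ^ 2 / (a t) ^ 2 - κ / (a t) ^ 2)
    (hf : ∀ t, f t = 3 * a'' t + (2 * C / a t) * G t)
    (hcond1 : Tendsto (fun t => ∫ s in t..t₁, a s * ∫ u in s..t₁, G u)
      (𝓝[>] t₀) atBot)
    (α : ℝ) (hα : 0 ≤ α)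
    (hcond2 : Tendsto (fun t => ∫ s in t..t₁, max (f s) 0) (𝓝[>] t₀) (𝓝 α))
    (θ θ' : ℝ → ℝ)
    (hθ : ∀ t ∈ Ioc t₀ t₁, HasDerivAt θ (θ' t) t)
    (hθ'_cont : ContinuousOn θ' (Ioc t₀ t₁))
    (hray : ∀ t ∈ Ioc t₀ t₁, θ' t ≤ f t / Real.sqrt (C + (a t) ^ 2)) :
    Tendsto (fun t => ∫ s in t..t₁, (a s / Real.sqrt (C + (a s) ^ 2)) * θ s)
      (𝓝[>] t₀) atTop := by
  have hca : ContinuousOn a (Ioc t₀ t₁) := ha_cont.mono Ioc_subset_Icc_self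
  have hca' : ContinuousOn a' (Ioc t₀ t₁) := fun t h => (ha'' t h).continuousAt.continuousWithinAt
  have hcθ : ContinuousOn θ (Ioc t₀ t₁) := fun t h => (hθ t h).continuousAt.continuousWithinAt
  have hane : ∀ t ∈ Ioc t₀ t₁, a t ≠ 0 := fun t h => (ha_pos t h).ne'
  have hcG : ContinuousOn G (Ioc t₀ t₁) := by
    rw [funext hG]
    exact ((ha''_cont.div hca hane).sub ((hca'.pow 2).div (hca.pow 2)
      fun t h => pow_ne_zero 2 (hane t h))).sub
      (continuousOn_const.div (hca.pow 2) fun t h => pow_ne_zero 2 (hane t h))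
  have hcf : ContinuousOn f (Ioc t₀ t₁) := by
    rw [funext hf]
    exact (continuousOn_const.mul ha''_cont).add ((continuousOn_const.div hca hane).mul hcG)
  have hcfp : ContinuousOn (fun t => max (f t) 0) (Ioc t₀ t₁) := hcf.sup continuousOn_const
  have hcfm : ContinuousOn (fun t => max (-f t) 0) (Ioc t₀ t₁) := hcf.neg.sup continuousOn_const
  have ht₁ : t₁ ∈ Ioc t₀ t₁ := ⟨ht, le_rfl⟩
  obtain ⟨M, hM⟩ : ∃ M, ∀ t ∈ Icc t₀ t₁, a t ≤ M := by
    obtain ⟨M, hM⟩ := isCompact_Icc.bddAbove_image ha_cont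
    exact ⟨M, fun t h => hM (mem_image_of_mem a h)⟩
  have haM : ∀ t ∈ Ioc t₀ t₁, a t ≤ M := fun t h => hM t (Ioc_subset_Icc_self h)
  have hM0 : 0 < M := (ha_pos t₁ ht₁).trans_le (haM t₁ ht₁)
  have hsq : ∀ t, 0 < C + a t ^ 2 := fun t => by positivity
  have hcsq : ContinuousOn (fun t => √(C + a t ^ 2)) (Ioc t₀ t₁) :=
    (continuousOn_const.add (hca.pow 2)).sqrt
  have hsqne : ∀ t ∈ Ioc t₀ t₁, √(C + a t ^ 2) ≠ 0 := fun t _ => (Real.sqrt_pos.2 (hsq t)).ne'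
  set m : ℝ := (√(C + M ^ 2))⁻¹
  set k : ℝ := (√C)⁻¹
  have hm0 : 0 < m := inv_pos.2 (Real.sqrt_pos.2 (by positivity))
  have hk0 : 0 < k := inv_pos.2 (Real.sqrt_pos.2 hC)
  have hmw : ∀ t ∈ Ioc t₀ t₁, m ≤ (√(C + a t ^ 2))⁻¹ := fun t h => by
    have h1 := ha_pos t h
    have h2 := haM t h
    exact inv_anti₀ (Real.sqrt_pos.2 (hsq t)) (Real.sqrt_le_sqrt (by gcongr))
  have hwk : ∀ t, (√(C + a t ^ 2))⁻¹ ≤ k := fun t =>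
    inv_anti₀ (Real.sqrt_pos.2 hC) (Real.sqrt_le_sqrt (by nlinarith [sq_nonneg (a t)]))
  set P : ℝ → ℝ := fun s => ∫ u in s..t₁, max (-f u) 0
  have hP0 : ∀ s ∈ Ioc t₀ t₁, 0 ≤ P s := fun s hs =>
    intervalIntegral.integral_nonneg hs.2 fun u _ => le_max_right _ _
  -- The Raychaudhuri inequality bounds `θ` below by the integral of the negative part of `f`.
  have hθP : ∀ s ∈ Ioc t₀ t₁, m * P s - (|θ t₁| + k * α) ≤ θ s := by
    intro s hs
    have h1 : ∫ u in s..t₁, θ' u ≤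
        ∫ u in s..t₁, (k * max (f u) 0 - m * max (-f u) 0) := by
      refine integral_mono_of_continuousOn_Ioc hθ'_cont
        ((continuousOn_const.mul hcfp).sub (continuousOn_const.mul hcfm)) (fun u hu => ?_) hs
      refine (hray u hu).trans ?_
      rw [div_eq_mul_inv]
      have hw1 := hmw u hu
      have hw2 := hwk u
      rcases le_total (f u) 0 with h | h
      · rw [max_eq_right h, max_eq_left (neg_nonneg.2 h)]
        nlinarith
      · rw [max_eq_left h, max_eq_right (neg_nonpos.2 h)]
        nlinarith
    rw [integral_eq_sub_of_continuousOn_Ioc hθ hθ'_cont hs,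
      intervalIntegral.integral_sub
        ((intervalIntegrable_of_continuousOn_Ioc hcfp hs).const_mul k)
        ((intervalIntegrable_of_continuousOn_Ioc hcfm hs).const_mul m),
      intervalIntegral.integral_const_mul, intervalIntegral.integral_const_mul] at h1
    have h2 := mul_le_mul_of_nonneg_left
      (integral_le_of_tendsto_of_nonneg hcfp (fun _ => le_max_right _ _) hcond2 hs) hk0.le
    have h3 := neg_abs_le (θ t₁)
    change _ ≤ _ - m * P s at h1
    linarith
  -- Integration by parts turns the integral of `G` into the one of `f`.
  have hGP : ∀ s ∈ Ioc t₀ t₁,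
      -(M * P s) - 3 * (a t₁ * a' t₁ - a s * a' s) ≤ 2 * C * ∫ u in s..t₁, G u := by
    intro s hs
    have hcd : ContinuousOn (fun u => a' u * a' u + a u * a'' u) (Ioc t₀ t₁) :=
      (hca'.mul hca').add (hca.mul ha''_cont)
    have h1 : ∫ u in s..t₁, (-M * max (-f u) 0 - 3 * (a' u * a' u + a u * a'' u)) ≤
        ∫ u in s..t₁, 2 * C * G u := by
      refine integral_mono_of_continuousOn_Ioc
        ((continuousOn_const.mul hcfm).sub (continuousOn_const.mul hcd))
        (continuousOn_const.mul hcG) (fun u hu => ?_) hs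
      have h2 : 2 * C * G u = a u * f u - 3 * (a u * a'' u) := by
        have := hane u hu
        rw [hf u]
        field_simp
        ring
      have h3 : -(M * max (-f u) 0) ≤ a u * f u := by
        have h4 : -f u ≤ max (-f u) 0 := le_max_left _ _
        have h5 : 0 ≤ max (-f u) 0 := le_max_right _ _
        nlinarith [mul_le_mul_of_nonneg_left h4 (ha_pos u hu).le,
          mul_le_mul_of_nonneg_right (haM u hu) h5]
      nlinarith [mul_self_nonneg (a' u)]
    rw [intervalIntegral.integral_const_mul, intervalIntegral.integral_sub
        ((intervalIntegrable_of_continuousOn_Ioc hcfm hs).const_mul _)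
        ((intervalIntegrable_of_continuousOn_Ioc hcd hs).const_mul _),
      intervalIntegral.integral_const_mul, intervalIntegral.integral_const_mul,
      integral_eq_sub_of_continuousOn_Ioc (g := fun u => a u * a' u)
        (fun u hu => (ha' u hu).mul (ha'' u hu)) hcd hs] at h1
    change -M * P s - _ ≤ _ at h1
    linarith
  set J : ℝ → ℝ := fun s => ∫ u in s..t₁, G u
  set c : ℝ := m ^ 2 / M
  have hc0 : 0 < c := by positivity
  have hcM : c * M = m ^ 2 := div_mul_cancel₀ _ hM0.ne'
  set D : ℝ := M * (3 * c * |a t₁ * a' t₁| + k * (|θ t₁| + k * α))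
  have hD0 : 0 ≤ D := by positivity
  have hpt : ∀ s ∈ Ioc t₀ t₁, -(2 * C * c) * (a s * J s) + c * (3 * a s ^ 2 * a' s) - D ≤
      a s / √(C + a s ^ 2) * θ s := by
    intro s hs
    have hapos := ha_pos s hs
    have hw1 := hmw s hs
    have hw2 := hwk s
    have hPs := hP0 s hs
    rw [div_eq_mul_inv]
    set w := (√(C + a s ^ 2))⁻¹
    have hw0 : 0 < w := hm0.trans_le hw1
    have hL : 0 ≤ |θ t₁| + k * α := by positivity
    have h1 : m ^ 2 * P s - k * (|θ t₁| + k * α) ≤ w * θ s := by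
      have h2 := mul_le_mul_of_nonneg_left (hθP s hs) hw0.le
      have h3 := mul_le_mul_of_nonneg_right hw1 (mul_nonneg hm0.le hPs)
      have h4 := mul_le_mul_of_nonneg_right hw2 hL
      linarith
    have h5 : -(2 * C * c) * J s + c * (3 * a s * a' s) - 3 * c * |a t₁ * a' t₁| ≤
        m ^ 2 * P s := by
      have h6 := mul_le_mul_of_nonneg_left (hGP s hs) hc0.le
      have h7 := mul_le_mul_of_nonneg_left (le_abs_self (a t₁ * a' t₁)) hc0.le
      rw [← hcM]
      change _ ≤ c * (2 * C * J s) at h6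
      linarith
    have h8 := mul_le_mul_of_nonneg_left (add_le_add h1 h5) hapos.le
    have h9 : a s * (3 * c * |a t₁ * a' t₁| + k * (|θ t₁| + k * α)) ≤ D :=
      mul_le_mul_of_nonneg_right (haM s hs) (by positivity)
    linarith
  have hcaJ : ContinuousOn (fun s => a s * J s) (Ioc t₀ t₁) :=
    hca.mul (continuousOn_primitive_Ioc hcG)
  have hca2 : ContinuousOn (fun s => 3 * a s ^ 2 * a' s) (Ioc t₀ t₁) :=
    (continuousOn_const.mul (hca.pow 2)).mul hca'
  have hbound : ∀ t ∈ Ioc t₀ t₁,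
      -(2 * C * c) * (∫ s in t..t₁, a s * J s) + (-(c * M ^ 3) - D * (t₁ - t₀)) ≤
        ∫ s in t..t₁, a s / √(C + a s ^ 2) * θ s := by
    intro t hts
    have h1 : ∫ s in t..t₁, (-(2 * C * c) * (a s * J s) + c * (3 * a s ^ 2 * a' s) - D) ≤
        ∫ s in t..t₁, a s / √(C + a s ^ 2) * θ s := integral_mono_of_continuousOn_Ioc
      (((continuousOn_const.mul hcaJ).add (continuousOn_const.mul hca2)).sub continuousOn_const)
      ((hca.div hcsq hsqne).mul hcθ) hpt hts
    have hi1 := (intervalIntegrable_of_continuousOn_Ioc hcaJ hts).const_mul (-(2 * C * c))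
    have hi2 := (intervalIntegrable_of_continuousOn_Ioc hca2 hts).const_mul c
    rw [intervalIntegral.integral_sub (hi1.add hi2) intervalIntegrable_const,
      intervalIntegral.integral_add hi1 hi2,
      intervalIntegral.integral_const_mul, intervalIntegral.integral_const_mul,
      integral_eq_sub_of_continuousOn_Ioc (g := fun u => a u ^ 3)
        (fun u hu => by simpa using (ha' u hu).fun_pow 3) hca2 hts,
      intervalIntegral.integral_const, smul_eq_mul] at h1
    have h2 : a t ^ 3 ≤ M ^ 3 := pow_le_pow_left₀ (ha_pos t hts).le (haM t hts) 3
    have h3 : 0 < a t₁ ^ 3 := pow_pos (ha_pos t₁ ht₁) 3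
    have h4 := mul_le_mul_of_nonneg_right (sub_le_sub_left hts.1.le t₁) hD0
    nlinarith [mul_le_mul_of_nonneg_left h2 hc0.le, mul_pos hc0 h3]
  have hdiv : Tendsto (fun t => -(2 * C * c) * (∫ s in t..t₁, a s * J s) +
      (-(c * M ^ 3) - D * (t₁ - t₀))) (𝓝[>] t₀) atTop :=
    tendsto_atTop_add_const_right _ _
      (hcond1.const_mul_atBot_of_neg (neg_lt_zero.2 (by positivity)))
  refine tendsto_atTop_mono' _ ?_ hdiv
  filter_upwards [Ioc_mem_nhdsGT ht] with t hts using hbound t hts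
end

section
/- Let t₀ < t₁ be reals, C > 0, M > 0, let a : (t₀,t₁] → ℝ satisfy 0 < a(t) ≤ M for all t, let f : (t₀,t₁] → ℝ be continuous, and let θ : (t₀,t₁] → ℝ be continuously differentiable with θ'(t) ≤ f(t)/√(C + a(t)²) for all t ∈ (t₀,t₁]. Then for every t ∈ (t₀,t₁], θ(t) ≥ −(1/√C)∫_t^{t₁} max(f(s),0) ds + (1/√(C + M²))∫_t^{t₁} max(−f(s),0) ds + θ(t₁). -/
open Filter Topology Set MeasureTheory intervalIntegral

/-- Bounding `x / y` by splitting `x` into its positive and negative parts. -/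
theorem div_le_posPart_sub_negPart {x y p q : ℝ} (hp : 0 < p) (hpy : p ≤ y) (hyq : y ≤ q) :
    x / y ≤ 1 / p * max x 0 - 1 / q * max (-x) 0 := by
  have hy : 0 < y := hp.trans_le hpy
  rcases le_total 0 x with hx | hx
  · rw [max_eq_left hx, max_eq_right (neg_nonpos.mpr hx), mul_zero, sub_zero, one_div_mul_eq_div]
    gcongr
  · rw [max_eq_right hx, max_eq_left (neg_nonneg.mpr hx), mul_zero, zero_sub, one_div_mul_eq_div,
      neg_div, neg_neg]
    have h : -x / q ≤ -x / y := div_le_div_of_nonneg_left (neg_nonneg.mpr hx) hy hyq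
    rw [neg_div, neg_div] at h
    linarith

/-- Paper's lower bound (Eq. 49) on the expansion `θ` along a timelike geodesic,
obtained by integrating the Raychaudhuri inequality
`θ' ≤ f/√(C + a²)` and splitting `f` into positive and negative parts. -/
theorem expansion_lower_bound
    (t₀ t₁ : ℝ) (ht : t₀ < t₁)
    (C M : ℝ) (hC : 0 < C) (hM : 0 < M)
    (a : ℝ → ℝ)
    (ha : ∀ t ∈ Ioc t₀ t₁, 0 < a t ∧ a t ≤ M)
    (f : ℝ → ℝ) (hf_cont : ContinuousOn f (Ioc t₀ t₁))
    (θ θ' : ℝ → ℝ)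
    (hθ : ∀ t ∈ Ioc t₀ t₁, HasDerivAt θ (θ' t) t)
    (hθ'_cont : ContinuousOn θ' (Ioc t₀ t₁))
    (hray : ∀ t ∈ Ioc t₀ t₁, θ' t ≤ f t / Real.sqrt (C + (a t) ^ 2)) :
    ∀ t ∈ Ioc t₀ t₁,
      θ t ≥ -(1 / Real.sqrt C) * (∫ s in t..t₁, max (f s) 0)
        + (1 / Real.sqrt (C + M ^ 2)) * (∫ s in t..t₁, max (-f s) 0)
        + θ t₁ := by
  intro t h
  have hsub : uIcc t t₁ ⊆ Ioc t₀ t₁ := by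
    rw [uIcc_of_le h.2]
    exact fun s hs => ⟨h.1.trans_le hs.1, hs.2⟩
  have hf := hf_cont.mono hsub
  have hpos : IntervalIntegrable (fun s => max (f s) 0) volume t t₁ :=
    (hf.sup continuousOn_const).intervalIntegrable
  have hneg : IntervalIntegrable (fun s => max (-f s) 0) volume t t₁ :=
    (hf.neg.sup continuousOn_const).intervalIntegrable
  have hint : IntervalIntegrable θ' volume t t₁ := (hθ'_cont.mono hsub).intervalIntegrable
  have hftc : ∫ s in t..t₁, θ' s = θ t₁ - θ t :=
    integral_eq_sub_of_hasDerivAt (fun s hs => hθ s (hsub hs)) hint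
  have hle : ∫ s in t..t₁, θ' s ≤ ∫ s in t..t₁,
      (1 / Real.sqrt C * max (f s) 0 - 1 / Real.sqrt (C + M ^ 2) * max (-f s) 0) := by
    refine integral_mono_on h.2 hint ((hpos.const_mul _).sub (hneg.const_mul _)) fun s hs => ?_
    have hs' : s ∈ Ioc t₀ t₁ := ⟨h.1.trans_le hs.1, hs.2⟩
    obtain ⟨has, haM⟩ := ha s hs'
    refine (hray s hs').trans (div_le_posPart_sub_negPart (Real.sqrt_pos.mpr hC) ?_ ?_)
    · exact Real.sqrt_le_sqrt (le_add_of_nonneg_right (sq_nonneg _))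
    · gcongr
  rw [integral_sub (hpos.const_mul _) (hneg.const_mul _), intervalIntegral.integral_const_mul,
    intervalIntegral.integral_const_mul] at hle
  linarith
end

section
/- Let t₀ < t₁ be reals, κ ∈ ℝ, and let a : ℝ → ℝ be positive and twice continuously differentiable on (t₀,t₁] with lim_{t→t₀⁺} a(t) = 0 and a bounded on (t₀,t₁]. If the function t ↦ ∫_t^{t₁} a(s) ∫_s^{t₁} (a'(u)² − κ)/a(u)³ du ds is bounded above on (t₀,t₁), then lim_{t→t₀⁺} ∫_t^{t₁} a(s) ∫_s^{t₁} (1/a(u))·(a''(u)/a(u) − a'(u)²/a(u)² − κ/a(u)²) du ds = −∞. -/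
open Filter Topology Set MeasureTheory intervalIntegral

theorem hasDerivAt_deriv_div_sq {f f' f'' : ℝ → ℝ} {x : ℝ} (hx : f x ≠ 0)
    (hf : HasDerivAt f (f' x) x) (hf' : HasDerivAt f' (f'' x) x) :
    HasDerivAt (fun u => f' u / f u ^ 2) (f'' x / f x ^ 2 - 2 * f' x ^ 2 / f x ^ 3) x := by
  refine (hf'.div (hf.pow 2) (pow_ne_zero 2 hx)).congr_deriv ?_
  simp only [Pi.pow_apply]
  field_simp
  push_cast
  ring

/-- Integration by parts for the averaged double integral: the second derivative is traded
for a boundary term and a logarithm. -/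
theorem double_integral_eq_log_add {t t₁ κ : ℝ} (ht : t ≤ t₁) {a a' a'' : ℝ → ℝ}
    (ha_pos : ∀ s ∈ Icc t t₁, 0 < a s)
    (ha' : ∀ s ∈ Icc t t₁, HasDerivAt a (a' s) s)
    (ha'' : ∀ s ∈ Icc t t₁, HasDerivAt a' (a'' s) s)
    (ha''_cont : ContinuousOn a'' (Icc t t₁)) :
    (∫ s in t..t₁, a s * ∫ u in s..t₁,
        (1 / a u) * (a'' u / a u - (a' u) ^ 2 / (a u) ^ 2 - κ / (a u) ^ 2)) =
      a' t₁ / a t₁ ^ 2 * (∫ s in t..t₁, a s) - (Real.log (a t₁) - Real.log (a t)) +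
        ∫ s in t..t₁, a s * ∫ u in s..t₁, ((a' u) ^ 2 - κ) / (a u) ^ 3 := by
  have ha_ne : ∀ s ∈ Icc t t₁, a s ≠ 0 := fun s hs => (ha_pos s hs).ne'
  have ca : ContinuousOn a (Icc t t₁) := fun s hs => (ha' s hs).continuousAt.continuousWithinAt
  have ca' : ContinuousOn a' (Icc t t₁) :=
    fun s hs => (ha'' s hs).continuousAt.continuousWithinAt
  have cpow : ∀ n : ℕ, ∀ s ∈ Icc t t₁, a s ^ n ≠ 0 := fun n s hs => pow_ne_zero n (ha_ne s hs)
  have cg : ContinuousOn (fun u => ((a' u) ^ 2 - κ) / (a u) ^ 3) (Icc t t₁) :=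
    ((ca'.pow 2).sub continuousOn_const).div (ca.pow 3) (cpow 3)
  have cd : ContinuousOn (fun u => a'' u / a u ^ 2 - 2 * a' u ^ 2 / a u ^ 3) (Icc t t₁) :=
    (ha''_cont.div (ca.pow 2) (cpow 2)).sub
      ((continuousOn_const.mul (ca'.pow 2)).div (ca.pow 3) (cpow 3))
  have inner : ∀ s ∈ Icc t t₁,
      (∫ u in s..t₁, (1 / a u) * (a'' u / a u - (a' u) ^ 2 / (a u) ^ 2 - κ / (a u) ^ 2)) =
        (a' t₁ / a t₁ ^ 2 - a' s / a s ^ 2) + ∫ u in s..t₁, ((a' u) ^ 2 - κ) / (a u) ^ 3 := by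
    intro s hs
    have hsub : uIcc s t₁ ⊆ Icc t t₁ := by
      rw [uIcc_of_le hs.2]
      exact Icc_subset_Icc_left hs.1
    have id := (cd.mono hsub).intervalIntegrable (μ := volume)
    rw [← integral_eq_sub_of_hasDerivAt
        (fun u hu => hasDerivAt_deriv_div_sq (ha_ne u (hsub hu)) (ha' u (hsub hu))
          (ha'' u (hsub hu))) id,
      ← integral_add id (cg.mono hsub).intervalIntegrable]
    refine integral_congr fun u hu => ?_
    have := ha_ne u (hsub hu)
    field_simp
    ring
  have hI : uIcc t t₁ = Icc t t₁ := uIcc_of_le ht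
  have cG : ContinuousOn (fun s => ∫ u in s..t₁, ((a' u) ^ 2 - κ) / (a u) ^ 3) (Icc t t₁) := by
    rw [← hI] at cg ⊢
    exact continuousOn_primitive_interval_left cg.integrableOn_uIcc
  have ia : IntervalIntegrable a volume t t₁ := (hI ▸ ca).intervalIntegrable
  have cl : ContinuousOn (fun s => a' s / a s) (uIcc t t₁) := hI ▸ ca'.div ca ha_ne
  have il := cl.intervalIntegrable (μ := volume)
  have iG : IntervalIntegrable (fun s => a s * ∫ u in s..t₁, ((a' u) ^ 2 - κ) / (a u) ^ 3)
      volume t t₁ := by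
    refine ContinuousOn.intervalIntegrable ?_
    rw [hI]
    exact ca.mul cG
  rw [← integral_eq_sub_of_hasDerivAt
      (fun s hs => (ha' s (hI ▸ hs)).log (ha_ne s (hI ▸ hs))) il,
    ← intervalIntegral.integral_const_mul, ← integral_sub (ia.const_mul _) il,
    ← integral_add ((ia.const_mul _).sub il) iG]
  refine integral_congr fun s hs => ?_
  rw [hI] at hs
  have h0 := ha_ne s hs
  have h1 := ha_ne t₁ (right_mem_Icc.2 ht)
  rw [inner s hs]
  field_simp

/-- Paper's corollary (Eq. 57) of the integration-by-parts identity: condition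
(33) of the main theorem is satisfied whenever the double integral of
`(a'² − κ)/a³` does not tend to `+∞`, because `log a(t) → −∞` at the
singularity. -/
theorem condition33_of_bounded_double_integral
    (t₀ t₁ : ℝ) (ht : t₀ < t₁) (κ : ℝ)
    (a a' a'' : ℝ → ℝ)
    (ha_pos : ∀ s ∈ Ioc t₀ t₁, 0 < a s)
    (ha' : ∀ s ∈ Ioc t₀ t₁, HasDerivAt a (a' s) s)
    (ha'' : ∀ s ∈ Ioc t₀ t₁, HasDerivAt a' (a'' s) s)
    (ha''_cont : ContinuousOn a'' (Ioc t₀ t₁))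
    (ha_lim : Tendsto a (𝓝[>] t₀) (𝓝 0))
    (ha_bdd : ∃ B : ℝ, ∀ s ∈ Ioc t₀ t₁, a s ≤ B)
    (hbdd : ∃ M : ℝ, ∀ t' ∈ Ioo t₀ t₁,
      (∫ s in t'..t₁, a s * ∫ u in s..t₁, ((a' u) ^ 2 - κ) / (a u) ^ 3) ≤ M) :
    Tendsto (fun t' => ∫ s in t'..t₁, a s * ∫ u in s..t₁,
        (1 / a u) * (a'' u / a u - (a' u) ^ 2 / (a u) ^ 2 - κ / (a u) ^ 2))
      (𝓝[>] t₀) atBot := by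
  obtain ⟨B, hB⟩ := ha_bdd
  obtain ⟨M, hM⟩ := hbdd
  have hmem : Ioo t₀ t₁ ∈ 𝓝[>] t₀ := Ioo_mem_nhdsGT ht
  have hlog : Tendsto (fun t => Real.log (a t)) (𝓝[>] t₀) atBot := by
    refine Real.tendsto_log_nhdsGT_zero.comp (tendsto_nhdsWithin_iff.2 ⟨ha_lim, ?_⟩)
    filter_upwards [hmem] with t h using ha_pos t ⟨h.1, h.2.le⟩
  refine tendsto_atBot_mono' _ ?_ (tendsto_atBot_add_const_right _
    (|a' t₁ / a t₁ ^ 2| * (B * (t₁ - t₀)) - Real.log (a t₁) + M) hlog)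
  filter_upwards [hmem] with t h
  have hsub : Icc t t₁ ⊆ Ioc t₀ t₁ := fun s hs => ⟨h.1.trans_le hs.1, hs.2⟩
  rw [double_integral_eq_log_add h.2.le (fun s hs => ha_pos s (hsub hs))
    (fun s hs => ha' s (hsub hs)) (fun s hs => ha'' s (hsub hs)) (ha''_cont.mono hsub)]
  have hB0 : 0 ≤ B := (ha_pos t₁ ⟨ht, le_rfl⟩).le.trans (hB t₁ ⟨ht, le_rfl⟩)
  have hnorm : |∫ s in t..t₁, a s| ≤ B * (t₁ - t₀) := by
    have hle : ∀ s ∈ uIoc t t₁, ‖a s‖ ≤ B := by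
      intro s hs
      rw [uIoc_of_le h.2.le] at hs
      have hs' := hsub (Ioc_subset_Icc_self hs)
      rw [Real.norm_of_nonneg (ha_pos s hs').le]
      exact hB s hs'
    have key := norm_integral_le_of_norm_le_const hle
    rw [Real.norm_eq_abs, abs_of_nonneg (sub_nonneg.2 h.2.le)] at key
    exact key.trans (mul_le_mul_of_nonneg_left (by linarith [h.1]) hB0)
  have hprod : a' t₁ / a t₁ ^ 2 * (∫ s in t..t₁, a s) ≤
      |a' t₁ / a t₁ ^ 2| * (B * (t₁ - t₀)) := by
    refine (le_abs_self _).trans ?_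
    rw [abs_mul]
    exact mul_le_mul_of_nonneg_left hnorm (abs_nonneg _)
  linarith [hM t h]
end

section
/- Let ε > 0 with ε ≠ 1 and ε ≠ 3, let κ ∈ ℝ, let 0 < t < t₁, and let a(u) = u^{1/ε}. Then ∫_t^{t₁} a(s) ∫_s^{t₁} (1/a(u))·(a''(u)/a(u) − a'(u)²/a(u)² − κ/a(u)²) du ds = (αε/(1+ε))·(t₁^{1/ε+1} − t^{1/ε+1}) − (1/(1+ε))·log(t₁/t) + (ε/(ε−3))·(ε/(2ε−2))·κ·(t₁^{2−2/ε} − t^{2−2/ε}), where α = 1/((1+ε)·t₁^{1/ε+1}) − (ε/(ε−3))·κ/t₁^{3/ε−1}. -/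
open Filter Topology Set MeasureTheory intervalIntegral

theorem zero_notMem_uIcc_of_pos {x y : ℝ} (hx : 0 < x) (hy : 0 < y) : (0 : ℝ) ∉ uIcc x y :=
  fun h => (lt_min hx hy).not_ge h.1

theorem deriv_deriv_rpow_of_pos (p : ℝ) {u : ℝ} (hu : 0 < u) :
    deriv (deriv fun x : ℝ => x ^ p) u = p * ((p - 1) * u ^ (p - 1 - 1)) := by
  have h : deriv (fun x : ℝ => x ^ p) =ᶠ[𝓝 u] fun x => p * x ^ (p - 1) := by
    filter_upwards [lt_mem_nhds hu] with x hx
    exact (Real.hasDerivAt_rpow_const (Or.inl hx.ne')).deriv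
  rw [h.deriv_eq]
  exact ((Real.hasDerivAt_rpow_const (Or.inl hu.ne')).const_mul p).deriv

theorem power_law_integrand_eq (p κ : ℝ) {u : ℝ} (hu : 0 < u) :
    (1 / u ^ p) * (deriv (deriv fun x : ℝ => x ^ p) u / u ^ p
        - (deriv (fun x : ℝ => x ^ p) u) ^ 2 / (u ^ p) ^ 2 - κ / (u ^ p) ^ 2)
      = -p * u ^ (-p - 2) - κ * u ^ (-(3 * p)) := by
  have hp : u ^ p ≠ 0 := (Real.rpow_pos_of_pos hu p).ne'
  have h3 : u ^ (-(3 * p)) = ((u ^ p) ^ 3)⁻¹ := by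
    rw [Real.rpow_neg hu.le, mul_comm, Real.rpow_mul hu.le]
    norm_cast
  have h2 : u ^ (-p - 2) = (u ^ p)⁻¹ / u ^ 2 := by
    rw [Real.rpow_sub hu, Real.rpow_neg hu.le]
    norm_cast
  rw [deriv_deriv_rpow_of_pos p hu, (Real.hasDerivAt_rpow_const (Or.inl hu.ne')).deriv, h3, h2,
    Real.rpow_sub_one hu.ne', Real.rpow_sub_one hu.ne']
  field_simp
  ring

theorem power_law_inner_integral_eq {p : ℝ} (hp : p + 1 ≠ 0) (hp3 : 1 - 3 * p ≠ 0) (κ : ℝ)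
    {s t₁ : ℝ} (hs : 0 < s) (ht₁ : 0 < t₁) :
    (∫ u in s..t₁, (1 / u ^ p) * (deriv (deriv fun x : ℝ => x ^ p) u / u ^ p
        - (deriv (fun x : ℝ => x ^ p) u) ^ 2 / (u ^ p) ^ 2 - κ / (u ^ p) ^ 2))
      = p / (p + 1) * (t₁ ^ (-(p + 1)) - s ^ (-(p + 1)))
        - κ / (1 - 3 * p) * (t₁ ^ (1 - 3 * p) - s ^ (1 - 3 * p)) := by
  have h0 := zero_notMem_uIcc_of_pos hs ht₁
  rw [integral_congr fun u hu => power_law_integrand_eq p κ ((lt_min hs ht₁).trans_le hu.1),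
    integral_sub ((intervalIntegrable_rpow (Or.inr h0)).const_mul _)
      ((intervalIntegrable_rpow (Or.inr h0)).const_mul _),
    intervalIntegral.integral_const_mul, intervalIntegral.integral_const_mul,
    integral_rpow (Or.inr ⟨fun h => hp (by linarith), h0⟩),
    integral_rpow (Or.inr ⟨fun h => hp3 (by linarith), h0⟩),
    show -p - 2 + 1 = -(p + 1) by ring, show -(3 * p) + 1 = 1 - 3 * p by ring, div_neg]
  ring

/-- Paper's explicit evaluation (Eq. 59) of the double integral in condition
(33) for a power-law scale factor `a(t) = t^(1/ε)`. -/
theorem power_law_double_integral_eval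
    (ε : ℝ) (hε : 0 < ε) (hε1 : ε ≠ 1) (hε3 : ε ≠ 3)
    (κ t t₁ : ℝ) (ht : 0 < t) (ht1 : t < t₁)
    (a : ℝ → ℝ) (ha : a = fun u => u ^ (1 / ε))
    (α : ℝ)
    (hα : α = 1 / ((1 + ε) * t₁ ^ (1 / ε + 1)) - (ε / (ε - 3)) * κ / t₁ ^ (3 / ε - 1)) :
    (∫ s in t..t₁, a s * ∫ u in s..t₁,
        (1 / a u) * (deriv (deriv a) u / a u - (deriv a u) ^ 2 / (a u) ^ 2
          - κ / (a u) ^ 2))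
      = (α * ε / (1 + ε)) * (t₁ ^ (1 / ε + 1) - t ^ (1 / ε + 1))
        - (1 / (1 + ε)) * Real.log (t₁ / t)
        + (ε / (ε - 3)) * (ε / (2 * ε - 2)) * κ
          * (t₁ ^ (2 - 2 / ε) - t ^ (2 - 2 / ε)) := by
  have ht₁ : 0 < t₁ := ht.trans ht1
  have h0 := zero_notMem_uIcc_of_pos ht ht₁
  have hε' : ε ≠ 0 := hε.ne'
  have hε1' : 1 + ε ≠ 0 := by positivity
  have hε3' : ε - 3 ≠ 0 := sub_ne_zero.2 hε3
  have hεm : ε - 1 ≠ 0 := sub_ne_zero.2 hε1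
  have hε2 : 2 * ε - 2 ≠ 0 := fun h => hεm (by linarith)
  have hp : 1 / ε + 1 ≠ 0 := by positivity
  have e3 : 1 - 3 * (1 / ε) = (ε - 3) / ε := by field_simp
  have e2 : 2 - 2 / ε = (2 * ε - 2) / ε := by field_simp
  have e1 : 1 / ε + 1 = (1 + ε) / ε := by field_simp
  have hp3 : 1 - 3 * (1 / ε) ≠ 0 := e3 ▸ div_ne_zero hε3' hε'
  have hp2 : 2 - 2 / ε ≠ 0 := e2 ▸ div_ne_zero hε2 hε'
  have c1 : 1 / ε / (1 / ε + 1) = 1 / (1 + ε) := by rw [e1]; field_simp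
  have c3 : κ / (1 - 3 * (1 / ε)) = ε / (ε - 3) * κ := by rw [e3]; field_simp
  have hα' : α = 1 / (1 + ε) * t₁ ^ (-(1 / ε + 1))
      - ε / (ε - 3) * κ * t₁ ^ (1 - 3 * (1 / ε)) := by
    rw [hα, show 1 - 3 * (1 / ε) = -(3 / ε - 1) by ring, Real.rpow_neg ht₁.le,
      Real.rpow_neg ht₁.le]
    field_simp
  subst ha
  have key : ∀ s ∈ uIcc t t₁, (fun s : ℝ => s ^ (1 / ε) * ∫ u in s..t₁,
      (1 / u ^ (1 / ε)) * (deriv (deriv fun x : ℝ => x ^ (1 / ε)) u / u ^ (1 / ε)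
        - (deriv (fun x : ℝ => x ^ (1 / ε)) u) ^ 2 / (u ^ (1 / ε)) ^ 2
        - κ / (u ^ (1 / ε)) ^ 2)) s
      = α * s ^ (1 / ε) - 1 / (1 + ε) * s⁻¹ + ε / (ε - 3) * κ * s ^ (1 - 2 / ε) := by
    intro s hs
    have hs0 : 0 < s := (lt_min ht ht₁).trans_le hs.1
    have m1 : s ^ (1 / ε) * s ^ (-(1 / ε + 1)) = s⁻¹ := by
      rw [← Real.rpow_add hs0, ← Real.rpow_neg_one]
      congr 1
      ring
    have m3 : s ^ (1 / ε) * s ^ (1 - 3 * (1 / ε)) = s ^ (1 - 2 / ε) := by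
      rw [← Real.rpow_add hs0]
      congr 1
      ring
    beta_reduce
    rw [power_law_inner_integral_eq hp hp3 κ hs0 ht₁, c1, c3, hα', ← m1, ← m3]
    ring
  have i1 : IntervalIntegrable (fun s : ℝ => α * s ^ (1 / ε)) volume t t₁ :=
    (intervalIntegrable_rpow (Or.inr h0)).const_mul _
  have i2 : IntervalIntegrable (fun s : ℝ => 1 / (1 + ε) * s⁻¹) volume t t₁ :=
    (intervalIntegrable_inv (fun x hx h => h0 (h ▸ hx)) continuousOn_id).const_mul _
  have i3 : IntervalIntegrable (fun s : ℝ => ε / (ε - 3) * κ * s ^ (1 - 2 / ε)) volume t t₁ :=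
    (intervalIntegrable_rpow (Or.inr h0)).const_mul _
  rw [integral_congr key, integral_add (i1.sub i2) i3, integral_sub i1 i2,
    intervalIntegral.integral_const_mul,
    intervalIntegral.integral_const_mul, intervalIntegral.integral_const_mul, integral_inv h0,
    integral_rpow (Or.inr ⟨fun h => hp (by linarith), h0⟩),
    integral_rpow (Or.inr ⟨fun h => hp2 (by linarith), h0⟩),
    show 1 - 2 / ε + 1 = 2 - 2 / ε by ring]
  have d1 (x : ℝ) : x / (1 / ε + 1) = ε / (1 + ε) * x := by rw [e1]; field_simp
  have d2 (x : ℝ) : x / (2 - 2 / ε) = ε / (2 * ε - 2) * x := by rw [e2]; field_simp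
  rw [d1, d2]
  ring
end

section
/- Let ε > 0, κ ∈ ℝ, t₁ > 0, and let a(u) = u^{1/ε}. If (0 < ε < 1 and κ > 0), or ε > 1, or κ = 0, or (ε = 1 and κ > −1), then lim_{t→0⁺} ∫_t^{t₁} a(s) ∫_s^{t₁} (1/a(u))·(a''(u)/a(u) − a'(u)²/a(u)² − κ/a(u)²) du ds = −∞. -/
open Filter Topology Set MeasureTheory intervalIntegral

/-- The curvature integrand of the power law `u ^ p` in closed form. -/
lemma rpow_curvature_integrand (p κ : ℝ) {u : ℝ} (hu : 0 < u) :
    1 / u ^ p * (deriv (deriv fun x : ℝ => x ^ p) u / u ^ p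
        - (deriv (fun x : ℝ => x ^ p) u) ^ 2 / (u ^ p) ^ 2 - κ / (u ^ p) ^ 2)
      = -(p * u ^ (-p - 2) + κ * u ^ (-(3 * p))) := by
  have hderiv : ∀ x : ℝ, 0 < x → deriv (fun x : ℝ => x ^ p) x = p * x ^ (p - 1) := fun x hx =>
    (Real.hasDerivAt_rpow_const (Or.inl hx.ne')).deriv
  have hderiv2 : deriv (deriv fun x : ℝ => x ^ p) u = p * ((p - 1) * u ^ (p - 1 - 1)) := by
    have heq : (deriv fun x : ℝ => x ^ p) =ᶠ[𝓝 u] fun x => p * x ^ (p - 1) := by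
      filter_upwards [lt_mem_nhds hu] with x hx using hderiv x hx
    rw [heq.deriv_eq]
    exact ((Real.hasDerivAt_rpow_const (Or.inl hu.ne')).const_mul p).deriv
  have hsub_two : u ^ (-p - 2) = (u ^ p)⁻¹ / u ^ 2 := by
    rw [Real.rpow_sub hu, Real.rpow_neg hu.le, Real.rpow_two]
  have hneg_three : u ^ (-(3 * p)) = ((u ^ p) ^ 3)⁻¹ := by
    rw [Real.rpow_neg hu.le, mul_comm, Real.rpow_mul hu.le]
    norm_cast
  have hpos : 0 < u ^ p := Real.rpow_pos_of_pos hu p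
  rw [hderiv2, hderiv u hu, hsub_two, hneg_three, Real.rpow_sub_one hu.ne',
    Real.rpow_sub_one hu.ne']
  field_simp
  ring

/-- If the dominant term has the right sign, the negated curvature integrand is bounded below by
a positive multiple of `u ^ (-p - 2)`, up to a constant. -/
lemma exists_curvature_lower_bound {p κ : ℝ} (hp : 0 < p)
    (h : 0 ≤ κ ∨ p < 1 ∨ (p = 1 ∧ -1 < κ)) :
    ∃ c > 0, ∃ C ≥ 0, ∀ u : ℝ, 0 < u →
      c * u ^ (-p - 2) - C ≤ p * u ^ (-p - 2) + κ * u ^ (-(3 * p)) := by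
  rcases le_or_gt 0 κ with hκ | hκ
  · refine ⟨p, hp, 0, le_rfl, fun u hu => ?_⟩
    have := mul_nonneg hκ (Real.rpow_nonneg hu.le (-(3 * p)))
    linarith
  rcases h with h | h | ⟨rfl, h⟩
  · exact absurd h hκ.not_ge
  · have hlim : Tendsto (fun u : ℝ => -κ * u ^ (2 - 2 * p)) (𝓝 0) (𝓝 0) := by
      have := (Real.continuousAt_rpow_const (0 : ℝ) (2 - 2 * p) (Or.inr (by linarith))).tendsto
      rw [Real.zero_rpow (by linarith)] at this
      simpa using this.const_mul (-κ)
    obtain ⟨δ, hδ, hsmall⟩ := Metric.eventually_nhds_iff.1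
      (hlim.eventually (gt_mem_nhds (show (0 : ℝ) < p / 2 by positivity)))
    refine ⟨p / 2, by positivity, -κ * δ ^ (-(3 * p)),
      mul_nonneg (by linarith) (Real.rpow_nonneg hδ.le _), fun u hu => ?_⟩
    have hpos : 0 < u ^ (-p - 2) := Real.rpow_pos_of_pos hu _
    have hδpos : 0 < δ ^ (-(3 * p)) := Real.rpow_pos_of_pos hδ _
    rcases lt_or_ge u δ with huδ | huδ
    · have hu2 : -κ * u ^ (2 - 2 * p) < p / 2 := hsmall (by simpa [abs_of_pos hu] using huδ)
      have hsplit : u ^ (-(3 * p)) = u ^ (2 - 2 * p) * u ^ (-p - 2) := by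
        rw [← Real.rpow_add hu]
        congr 1
        ring
      rw [hsplit]
      nlinarith
    · have hle : u ^ (-(3 * p)) ≤ δ ^ (-(3 * p)) :=
        Real.rpow_le_rpow_of_nonpos hδ huδ (by linarith)
      nlinarith
  · refine ⟨1 + κ, by linarith, 0, le_rfl, fun u _ => ?_⟩
    norm_num
    linarith

/-- A weight `s ^ p` times the tail integral of a function that grows like `u ^ (-p - 2)` at `0`
grows at least like `1 / s`. -/
lemma exists_inv_le_rpow_mul_integral {p c C b : ℝ} (hp : 0 < p) (hc : 0 < c) (hC : 0 ≤ C)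
    (hb : 0 < b) {f : ℝ → ℝ} (hf : ContinuousOn f (Ioi 0))
    (hle : ∀ u, 0 < u → c * u ^ (-p - 2) - C ≤ f u) :
    ∃ c' > 0, ∃ C', ∀ s ∈ Ioc 0 b, c' * s⁻¹ - C' ≤ s ^ p * ∫ u in s..b, f u := by
  refine ⟨c / (p + 1), by positivity, b ^ p * (c / (p + 1) * b ^ (-p - 1) + C * b), ?_⟩
  rintro s ⟨hs, hsb⟩
  have hsub : uIcc s b ⊆ Ioi 0 := by
    rw [uIcc_of_le hsb]
    exact fun x hx => hs.trans_le hx.1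
  have hzero : (0 : ℝ) ∉ uIcc s b := fun h => self_notMem_Ioi (hsub h)
  have hpow : IntervalIntegrable (fun u : ℝ => c * u ^ (-p - 2)) volume s b :=
    (intervalIntegrable_rpow (Or.inr hzero)).const_mul c
  have hmono : ∫ u in s..b, (c * u ^ (-p - 2) - C) ≤ ∫ u in s..b, f u :=
    integral_mono_on hsb (hpow.sub intervalIntegrable_const)
      (hf.mono hsub).intervalIntegrable fun u hu => hle u (hs.trans_le hu.1)
  have hval : ∫ u in s..b, (c * u ^ (-p - 2) - C)
      = c / (p + 1) * (s ^ (-p - 1) - b ^ (-p - 1)) - C * (b - s) := by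
    rw [integral_sub hpow intervalIntegrable_const, intervalIntegral.integral_const_mul,
      integral_rpow (Or.inr ⟨by linarith, hzero⟩), intervalIntegral.integral_const,
      show -p - 2 + 1 = -p - 1 by ring, smul_eq_mul]
    have hp1 : p + 1 ≠ 0 := by positivity
    have hp1' : -p - 1 ≠ 0 := by linarith
    field_simp
    ring
  have hinv : s ^ p * s ^ (-p - 1) = s⁻¹ := by
    rw [← Real.rpow_add hs, show p + (-p - 1) = -1 by ring, Real.rpow_neg_one]
  have hspos : 0 < s ^ p := Real.rpow_pos_of_pos hs p
  have hspow : s ^ p ≤ b ^ p := Real.rpow_le_rpow hs.le hsb hp.le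
  have hconst : 0 ≤ c / (p + 1) * b ^ (-p - 1) + C * b := by positivity
  calc c / (p + 1) * s⁻¹ - b ^ p * (c / (p + 1) * b ^ (-p - 1) + C * b)
      ≤ c / (p + 1) * (s ^ p * s ^ (-p - 1))
          - s ^ p * (c / (p + 1) * b ^ (-p - 1) + C * b) + s ^ p * (C * s) := by
        rw [hinv]
        have h₁ := mul_le_mul_of_nonneg_right hspow hconst
        have h₂ : 0 ≤ s ^ p * (C * s) := by positivity
        linarith
    _ = s ^ p * (c / (p + 1) * (s ^ (-p - 1) - b ^ (-p - 1)) - C * (b - s)) := by ring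
    _ ≤ s ^ p * ∫ u in s..b, f u := by
        rw [← hval]
        exact mul_le_mul_of_nonneg_left hmono hspos.le

lemma tendsto_integral_atTop_of_inv_le {c C b : ℝ} (hc : 0 < c) (hb : 0 < b) {g : ℝ → ℝ}
    (hg : ContinuousOn g (Ioi 0)) (hle : ∀ s ∈ Ioc 0 b, c * s⁻¹ - C ≤ g s) :
    Tendsto (fun t => ∫ s in t..b, g s) (𝓝[>] 0) atTop := by
  have hlog : Tendsto (fun t => c * Real.log b - C * b + (C * t + -c * Real.log t))
      (𝓝[>] 0) atTop := by
    refine tendsto_atTop_add_const_left _ _ (Tendsto.add_atTop (C := C * 0) ?_ ?_)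
    · exact ((continuous_const.mul continuous_id).tendsto 0).mono_left nhdsWithin_le_nhds
    · exact Real.tendsto_log_nhdsGT_zero.const_mul_atBot_of_neg (neg_lt_zero.2 hc)
  refine tendsto_atTop_mono' _ ?_ hlog
  filter_upwards [Ioc_mem_nhdsGT hb] with t ⟨ht, htb⟩
  have hsub : uIcc t b ⊆ Ioi 0 := by
    rw [uIcc_of_le htb]
    exact fun x hx => ht.trans_le hx.1
  have hzero : (0 : ℝ) ∉ uIcc t b := fun h => self_notMem_Ioi (hsub h)
  have hinv : IntervalIntegrable (fun s : ℝ => c * s⁻¹) volume t b :=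
    (intervalIntegrable_inv (fun x hx => (hsub hx).ne') continuousOn_id).const_mul c
  calc c * Real.log b - C * b + (C * t + -c * Real.log t)
      = ∫ s in t..b, (c * s⁻¹ - C) := by
        rw [integral_sub hinv intervalIntegrable_const, intervalIntegral.integral_const_mul,
          integral_inv hzero, intervalIntegral.integral_const, Real.log_div hb.ne' ht.ne',
          smul_eq_mul]
        ring
    _ ≤ ∫ s in t..b, g s :=
        integral_mono_on htb (hinv.sub intervalIntegrable_const)
          (hg.mono hsub).intervalIntegrable fun s hs => hle s ⟨ht.trans_le hs.1, hs.2⟩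

lemma continuousOn_Ioi_integral_left {f : ℝ → ℝ} {b : ℝ} (hb : 0 < b)
    (hf : ContinuousOn f (Ioi 0)) : ContinuousOn (fun s => ∫ u in s..b, f u) (Ioi 0) := by
  intro s hs
  have hsub : uIcc s b ⊆ Ioi 0 := (convex_Ioi (0 : ℝ)).ordConnected.uIcc_subset hs hb
  exact (integral_hasDerivAt_left (hf.mono hsub).intervalIntegrable
    (hf.stronglyMeasurableAtFilter isOpen_Ioi s hs)
    (hf.continuousAt (Ioi_mem_nhds hs))).continuousAt.continuousWithinAt

/-- Paper's verification that condition (33) of its main theorem holds for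
power-law scale factors `a(t) = t^(1/ε)` in the listed cases. -/
theorem power_law_condition33
    (ε : ℝ) (hε : 0 < ε) (κ t₁ : ℝ) (ht₁ : 0 < t₁)
    (a : ℝ → ℝ) (ha : a = fun u => u ^ (1 / ε))
    (hcase : (0 < ε ∧ ε < 1 ∧ 0 < κ) ∨ 1 < ε ∨ κ = 0 ∨ (ε = 1 ∧ -1 < κ)) :
    Tendsto (fun t => ∫ s in t..t₁, a s * ∫ u in s..t₁,
        (1 / a u) * (deriv (deriv a) u / a u - (deriv a u) ^ 2 / (a u) ^ 2
          - κ / (a u) ^ 2))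
      (𝓝[>] (0 : ℝ)) atBot := by
  subst ha
  have hp : 0 < 1 / ε := by positivity
  have hsign : 0 ≤ κ ∨ 1 / ε < 1 ∨ (1 / ε = 1 ∧ -1 < κ) := by
    rcases hcase with ⟨-, -, h⟩ | h | h | ⟨h, h'⟩
    · exact Or.inl h.le
    · exact Or.inr (Or.inl ((div_lt_one hε).2 h))
    · exact Or.inl h.ge
    · exact Or.inr (Or.inr ⟨by rw [h, div_one], h'⟩)
  generalize 1 / ε = p at hp hsign
  let f : ℝ → ℝ := fun u => p * u ^ (-p - 2) + κ * u ^ (-(3 * p))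
  have hrpow : ∀ q : ℝ, ContinuousOn (fun u : ℝ => u ^ q) (Ioi 0) := fun q =>
    continuousOn_id.rpow_const fun x hx => Or.inl (ne_of_gt hx)
  have hf : ContinuousOn f (Ioi 0) :=
    (continuousOn_const.mul (hrpow _)).add (continuousOn_const.mul (hrpow _))
  obtain ⟨c, hc, C, hC, hle⟩ := exists_curvature_lower_bound hp hsign
  obtain ⟨c', hc', C', hle'⟩ := exists_inv_le_rpow_mul_integral hp hc hC ht₁ hf hle
  have htop := tendsto_integral_atTop_of_inv_le hc' ht₁
    ((hrpow p).mul (continuousOn_Ioi_integral_left ht₁ hf)) hle'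
  refine (tendsto_neg_atTop_atBot.comp htop).congr' ?_
  filter_upwards [self_mem_nhdsWithin] with t ht
  have hconn : OrdConnected (Ioi (0 : ℝ)) := ordConnected_Ioi
  rw [Function.comp_apply, ← intervalIntegral.integral_neg]
  refine integral_congr fun s hs => ?_
  have hs0 : s ∈ Ioi (0 : ℝ) := hconn.uIcc_subset ht ht₁ hs
  rw [Pi.mul_apply, ← mul_neg, ← intervalIntegral.integral_neg]
  congr 1
  exact integral_congr fun u hu =>
    (rpow_curvature_integrand p κ (hconn.uIcc_subset hs0 ht₁ hu)).symm
end

section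
/- Let κ ∈ ℝ, t₁ > 0, and let a(u) = u. Then lim_{t→0⁺} ∫_t^{t₁} a(s) ∫_s^{t₁} (1/a(u))·(a''(u)/a(u) − a'(u)²/a(u)² − κ/a(u)²) du ds = −∞ if and only if κ > −1. -/
open Filter Topology Set MeasureTheory intervalIntegral

theorem integral_inv_cube {s t : ℝ} (hs : 0 < s) (hst : s ≤ t) :
    ∫ u in s..t, (u ^ 3)⁻¹ = (1 / s ^ 2 - 1 / t ^ 2) / 2 := by
  have hpos : ∀ u ∈ uIcc s t, 0 < u := fun u hu => by
    rw [uIcc_of_le hst] at hu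
    exact hs.trans_le hu.1
  have hderiv : ∀ u ∈ uIcc s t,
      HasDerivAt (fun u : ℝ => -(u ^ 2)⁻¹ / 2) ((u ^ 3)⁻¹) u := fun u hu => by
    have hu0 : u ≠ 0 := (hpos u hu).ne'
    refine (((hasDerivAt_pow 2 u).inv (pow_ne_zero 2 hu0)).neg.div_const 2).congr_deriv ?_
    field_simp
    norm_num [mul_comm]
  rw [integral_eq_sub_of_hasDerivAt hderiv]
  · ring
  · refine ContinuousOn.intervalIntegrable fun u hu => ?_
    exact ((continuous_pow 3).continuousAt.inv₀
      (pow_ne_zero 3 (hpos u hu).ne')).continuousWithinAt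

theorem integral_inv_sub_div_sq {t t₁ : ℝ} (ht : 0 < t) (htt : t ≤ t₁) :
    ∫ s in t..t₁, (s⁻¹ - s / t₁ ^ 2) =
      Real.log (t₁ / t) - (t₁ ^ 2 - t ^ 2) / (2 * t₁ ^ 2) := by
  have hint : IntervalIntegrable (fun s : ℝ => s⁻¹) volume t t₁ :=
    intervalIntegrable_inv_iff.2 (Or.inr fun h => by
      rw [uIcc_of_le htt] at h
      exact ht.not_ge h.1)
  rw [integral_sub hint (by apply Continuous.intervalIntegrable; fun_prop),
    integral_inv_of_pos ht (ht.trans_le htt), intervalIntegral.integral_div, integral_id]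
  ring

theorem tendsto_log_div_sub_atTop {t₁ : ℝ} (ht₁ : 0 < t₁) :
    Tendsto (fun t => Real.log (t₁ / t) - (t₁ ^ 2 - t ^ 2) / (2 * t₁ ^ 2))
      (𝓝[>] (0 : ℝ)) atTop := by
  have hlog : Tendsto (fun t => Real.log (t₁ / t)) (𝓝[>] (0 : ℝ)) atTop :=
    Real.tendsto_log_atTop.comp (tendsto_inv_nhdsGT_zero.const_mul_atTop ht₁)
  have hrest : Continuous fun t : ℝ => -((t₁ ^ 2 - t ^ 2) / (2 * t₁ ^ 2)) := by fun_prop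
  simpa only [sub_eq_add_neg] using
    hlog.atTop_add ((hrest.tendsto 0).mono_left nhdsWithin_le_nhds)

theorem integral_linear_scale_factor (κ : ℝ) {t t₁ : ℝ} (ht : 0 < t) (htt : t ≤ t₁) :
    ∫ s in t..t₁, s * ∫ u in s..t₁, (1 / u) * (0 / u - 1 ^ 2 / u ^ 2 - κ / u ^ 2) =
      -(1 + κ) / 2 * (Real.log (t₁ / t) - (t₁ ^ 2 - t ^ 2) / (2 * t₁ ^ 2)) := by
  rw [← integral_inv_sub_div_sq ht htt, ← intervalIntegral.integral_const_mul]
  refine integral_congr fun s hs => ?_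
  rw [uIcc_of_le htt] at hs
  have hs0 : 0 < s := ht.trans_le hs.1
  have hinner : ∀ u : ℝ, (1 / u) * (0 / u - 1 ^ 2 / u ^ 2 - κ / u ^ 2) =
      -(1 + κ) * (u ^ 3)⁻¹ := fun u => by
    simp only [div_eq_mul_inv, ← inv_pow]
    ring
  simp only [hinner]
  rw [intervalIntegral.integral_const_mul, integral_inv_cube hs0 hs.2]
  field_simp

/-- Paper's claim for the borderline power-law case `ε = 1`, i.e. scale factor
`a(t) = t`: condition (33) of its main theorem holds if and only if the
spatial curvature satisfies `κ > -1`. -/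
theorem linear_scale_factor_condition33_iff
    (κ t₁ : ℝ) (ht₁ : 0 < t₁)
    (a : ℝ → ℝ) (ha : a = fun u => u) :
    Tendsto (fun t => ∫ s in t..t₁, a s * ∫ u in s..t₁,
        (1 / a u) * (deriv (deriv a) u / a u - (deriv a u) ^ 2 / (a u) ^ 2
          - κ / (a u) ^ 2))
      (𝓝[>] (0 : ℝ)) atBot ↔ -1 < κ := by
  subst ha
  have hd : deriv (fun u : ℝ => u) = fun _ => 1 := deriv_id'
  simp only [hd, deriv_const]
  have hG := tendsto_log_div_sub_atTop ht₁
  rw [tendsto_congr' (f₂ := fun t => -(1 + κ) / 2 *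
    (Real.log (t₁ / t) - (t₁ ^ 2 - t ^ 2) / (2 * t₁ ^ 2)))]
  · rw [tendsto_const_mul_atBot_iff]
    constructor
    · rintro (⟨_, h⟩ | ⟨h, _⟩)
      · exact (h.not_tendsto disjoint_atBot_atTop hG).elim
      · linarith
    · exact fun h => Or.inr ⟨by linarith, hG⟩
  · filter_upwards [Ioo_mem_nhdsGT ht₁] with t ht
    exact integral_linear_scale_factor κ ht.1 ht.2.le
end

section
/- Let ε > 0, κ ∈ ℝ, C > 0, let a(t) = t^{1/ε}, and let f(t) = 3a''(t) + (2C/a(t))·(a''(t)/a(t) − a'(t)²/a(t)² − κ/a(t)²), so that f(t) = 3(1/ε)(1/ε − 1)·t^{1/ε − 2} − 2C·((1/ε)·t^{−2−1/ε} + κ·t^{−3/ε}). If (0 < ε < 1 and κ > 0), or ε > 1, or κ = 0, or (ε = 1 and κ > −1), then lim_{t→0⁺} f(t) = −∞. -/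
open Filter Topology Set MeasureTheory intervalIntegral

lemma deriv_deriv_rpow_const {p t : ℝ} (ht : 0 < t) :
    deriv (deriv fun x : ℝ => x ^ p) t = p * (p - 1) * t ^ (p - 2) := by
  have h : deriv (fun x : ℝ => x ^ p) =ᶠ[𝓝 t] fun x => p * x ^ (p - 1) := by
    filter_upwards [lt_mem_nhds ht] with x hx
    exact (Real.hasDerivAt_rpow_const (Or.inl hx.ne')).deriv
  rw [h.deriv_eq,
    ((Real.hasDerivAt_rpow_const (p := p - 1) (Or.inl ht.ne')).const_mul p).deriv,
    show p - 1 - 1 = p - 2 by ring]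
  ring

lemma tendsto_rpow_nhdsGT_zero {q : ℝ} (hq : 0 < q) :
    Tendsto (fun t : ℝ => t ^ q) (𝓝[>] 0) (𝓝 0) := by
  have h := (Real.continuousAt_rpow_const 0 q (Or.inr hq.le)).tendsto
  rw [Real.zero_rpow hq.ne'] at h
  exact h.mono_left nhdsWithin_le_nhds

lemma tendsto_rpow_neg_nhdsGT_zero_atTop {q : ℝ} (hq : 0 < q) :
    Tendsto (fun t : ℝ => t ^ (-q)) (𝓝[>] 0) atTop := by
  refine ((tendsto_rpow_atTop hq).comp tendsto_inv_nhdsGT_zero).congr' ?_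
  filter_upwards [self_mem_nhdsWithin] with t ht
  rw [Function.comp_apply, Real.inv_rpow (le_of_lt ht), Real.rpow_neg (le_of_lt ht)]

/-- If `κ * t ^ (2 - 2 * p)` is bounded below by some `h` tending to `L > -p` at `0⁺`, then the
term `t ^ (-2 - p)` dominates and the sum tends to `-∞`. -/
lemma tendsto_power_law_atBot {p κ C L : ℝ} (hp : 0 < p) (hC : 0 < C) {h : ℝ → ℝ}
    (hL : Tendsto h (𝓝[>] 0) (𝓝 L)) (hpL : 0 < p + L)
    (hle : ∀ t, 0 < t → h t ≤ κ * t ^ (2 - 2 * p)) :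
    Tendsto (fun t : ℝ => 3 * p * (p - 1) * t ^ (p - 2)
      - 2 * C * (p * t ^ (-2 - p) + κ * t ^ (-(3 * p)))) (𝓝[>] 0) atBot := by
  have hlim : Tendsto (fun t => 3 * p * (p - 1) * t ^ (2 * p) - 2 * C * (p + h t)) (𝓝[>] 0)
      (𝓝 (3 * p * (p - 1) * 0 - 2 * C * (p + L))) :=
    ((tendsto_rpow_nhdsGT_zero (by positivity)).const_mul _).sub
      ((hL.const_add p).const_mul (2 * C))
  have hneg : 3 * p * (p - 1) * 0 - 2 * C * (p + L) < 0 := by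
    have : 0 < C * (p + L) := mul_pos hC hpL
    linarith
  refine tendsto_atBot_mono' _ ?_
    ((tendsto_rpow_neg_nhdsGT_zero_atTop (q := 2 + p) (by positivity)).atTop_mul_neg hneg hlim)
  filter_upwards [self_mem_nhdsWithin] with t ht
  have ht : 0 < t := ht
  have h₁ : t ^ (p - 2) = t ^ (-(2 + p)) * t ^ (2 * p) := by
    rw [← Real.rpow_add ht]; ring_nf
  have h₂ : t ^ (-(3 * p)) = t ^ (-(2 + p)) * t ^ (2 - 2 * p) := by
    rw [← Real.rpow_add ht]; ring_nf
  rw [h₁, h₂, show -2 - p = -(2 + p) by ring]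
  have := mul_le_mul_of_nonneg_left (hle t ht)
    (mul_pos hC (Real.rpow_pos_of_pos ht (-(2 + p)))).le
  linarith

/-- Paper's verification (Eq. 61 and following) that for power-law scale
factors `a(t) = t^(1/ε)` in the listed cases, the function `f` of its main
theorem has its stated closed form and tends to `-∞` at the singularity. -/
theorem power_law_f_tendsto_atBot
    (ε : ℝ) (hε : 0 < ε) (κ C : ℝ) (hC : 0 < C)
    (a : ℝ → ℝ) (ha : a = fun t => t ^ (1 / ε))
    (f : ℝ → ℝ)
    (hf : ∀ t, f t = 3 * deriv (deriv a) t
      + (2 * C / a t) * (deriv (deriv a) t / a t - (deriv a t) ^ 2 / (a t) ^ 2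
          - κ / (a t) ^ 2))
    (hcase : (0 < ε ∧ ε < 1 ∧ 0 < κ) ∨ 1 < ε ∨ κ = 0 ∨ (ε = 1 ∧ -1 < κ)) :
    (∀ t : ℝ, 0 < t →
      f t = 3 * (1 / ε) * (1 / ε - 1) * t ^ (1 / ε - 2)
        - 2 * C * ((1 / ε) * t ^ (-2 - 1 / ε) + κ * t ^ (-(3 / ε)))) ∧
    Tendsto f (𝓝[>] (0 : ℝ)) atBot := by
  have hp : 0 < 1 / ε := by positivity
  have key : ∀ t : ℝ, 0 < t →
      f t = 3 * (1 / ε) * (1 / ε - 1) * t ^ (1 / ε - 2)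
        - 2 * C * ((1 / ε) * t ^ (-2 - 1 / ε) + κ * t ^ (-(3 / ε))) := by
    intro t ht
    rw [hf, ha, deriv_deriv_rpow_const ht,
      (Real.hasDerivAt_rpow_const (Or.inl ht.ne')).deriv, show 3 / ε = 3 * (1 / ε) by ring]
    generalize 1 / ε = p
    have h₁ : t ^ (p - 2) = t ^ p / t ^ 2 := by
      rw [Real.rpow_sub ht, Real.rpow_two]
    have h₂ : t ^ (p - 1) = t ^ p / t := by
      rw [Real.rpow_sub ht, Real.rpow_one]
    have h₃ : t ^ (-2 - p) = 1 / (t ^ 2 * t ^ p) := by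
      rw [Real.rpow_sub ht, Real.rpow_neg ht.le, Real.rpow_two]
      field_simp
    have h₄ : t ^ (-(3 * p)) = 1 / (t ^ p) ^ 3 := by
      rw [Real.rpow_neg ht.le, mul_comm, Real.rpow_mul ht.le, one_div]
      norm_cast
    rw [h₁, h₂, h₃, h₄]
    have := Real.rpow_pos_of_pos ht p
    field_simp
    ring
  refine ⟨key, ?_⟩
  suffices H : ∃ (h : ℝ → ℝ) (L : ℝ), Tendsto h (𝓝[>] 0) (𝓝 L) ∧ 0 < 1 / ε + L ∧
      ∀ t, 0 < t → h t ≤ κ * t ^ (2 - 2 * (1 / ε)) by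
    obtain ⟨h, L, hL, hpL, hle⟩ := H
    refine (tendsto_power_law_atBot hp hC hL hpL hle).congr' ?_
    filter_upwards [self_mem_nhdsWithin] with t ht
    rw [key t ht, show 3 / ε = 3 * (1 / ε) by ring]
  rcases hcase with ⟨-, -, hκ⟩ | hε' | rfl | ⟨rfl, hκ⟩
  · exact ⟨fun _ => 0, 0, tendsto_const_nhds, by simpa using hε,
      fun t ht => mul_nonneg hκ.le (Real.rpow_nonneg ht.le _)⟩
  · have hp' : 1 / ε < 1 := (div_lt_one hε).2 hε'
    exact ⟨_, _, (tendsto_rpow_nhdsGT_zero (by linarith)).const_mul κ, by simpa using hε,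
      fun _ _ => le_rfl⟩
  · exact ⟨fun _ => 0, 0, tendsto_const_nhds, by simpa using hε, fun _ _ => by simp⟩
  · exact ⟨fun _ => κ, κ, tendsto_const_nhds, by linarith, fun _ _ => by norm_num⟩
end

section
/- Let ε ≥ 1, κ ∈ ℝ, and let a(t) = −t^{1/ε}·log t for 0 < t < 1. Then lim_{t→0⁺} t²·(a''(t)/a(t) − a'(t)²/a(t)² − κ/a(t)²) = −1/ε. -/
open Filter Topology Set MeasureTheory intervalIntegral

lemma hasDerivAt_neg_rpow_mul_log (p : ℝ) {t : ℝ} (ht : 0 < t) :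
    HasDerivAt (fun u : ℝ => -(u ^ p) * Real.log u)
      (-(t ^ (p - 1)) * (p * Real.log t + 1)) t := by
  have h := (Real.hasDerivAt_rpow_const (p := p) (Or.inl ht.ne')).neg.mul
    (Real.hasDerivAt_log ht.ne')
  refine h.congr_deriv ?_
  simp only [Pi.neg_apply]
  rw [Real.rpow_sub_one ht.ne']
  field_simp
  ring

lemma hasDerivAt_neg_rpow_mul_log_add_one (p : ℝ) {t : ℝ} (ht : 0 < t) :
    HasDerivAt (fun u : ℝ => -(u ^ (p - 1)) * (p * Real.log u + 1))
      (-(t ^ p / t ^ 2) * ((p - 1) * (p * Real.log t + 1) + p)) t := by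
  have h := (Real.hasDerivAt_rpow_const (p := p - 1) (Or.inl ht.ne')).neg.mul
    (((Real.hasDerivAt_log ht.ne').const_mul p).add_const 1)
  refine h.congr_deriv ?_
  simp only [Pi.neg_apply]
  rw [Real.rpow_sub_one ht.ne' (p - 1), Real.rpow_sub_one ht.ne' p]
  field_simp
  ring

lemma deriv_deriv_neg_rpow_mul_log (p : ℝ) {t : ℝ} (ht : 0 < t) :
    deriv (deriv fun u : ℝ => -(u ^ p) * Real.log u) t =
      -(t ^ p / t ^ 2) * ((p - 1) * (p * Real.log t + 1) + p) := by
  have h : deriv (fun u : ℝ => -(u ^ p) * Real.log u) =ᶠ[𝓝 t]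
      fun u => -(u ^ (p - 1)) * (p * Real.log u + 1) := by
    filter_upwards [Ioi_mem_nhds ht] with u hu
    exact (hasDerivAt_neg_rpow_mul_log p hu).deriv
  rw [h.deriv_eq, (hasDerivAt_neg_rpow_mul_log_add_one p ht).deriv]

lemma tendsto_inv_log_nhdsGT_zero :
    Tendsto (fun t : ℝ => (Real.log t)⁻¹) (𝓝[>] 0) (𝓝 0) :=
  tendsto_inv_atBot_zero.comp Real.tendsto_log_nhdsGT_zero

lemma tendsto_rpow_mul_inv_log_nhdsGT_zero {q : ℝ} (hq : 0 ≤ q) :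
    Tendsto (fun t : ℝ => t ^ q * (Real.log t)⁻¹) (𝓝[>] 0) (𝓝 0) := by
  have h : Tendsto (fun t : ℝ => ‖(Real.log t)⁻¹‖) (𝓝[>] 0) (𝓝 0) := by
    simpa using tendsto_inv_log_nhdsGT_zero.norm
  refine squeeze_zero_norm' ?_ h
  filter_upwards [Ioo_mem_nhdsGT (zero_lt_one' ℝ)] with t ht
  rw [norm_mul, Real.norm_of_nonneg (Real.rpow_nonneg ht.1.le q)]
  exact mul_le_of_le_one_left (norm_nonneg _) (Real.rpow_le_one ht.1.le ht.2.le hq)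

/-- Paper's asymptotic claim (Eq. 64, case `ε ≥ 1`) for the logarithmically
corrected scale factor `a(t) = -t^(1/ε) * log t` near the singularity: the
term `-1/(εt²)` dominates. -/
theorem log_corrected_asymptotics_eps_ge_one
    (ε : ℝ) (hε : 1 ≤ ε) (κ : ℝ)
    (a : ℝ → ℝ) (ha : a = fun u => -(u ^ (1 / ε)) * Real.log u) :
    Tendsto (fun t => t ^ 2 *
        (deriv (deriv a) t / a t - (deriv a t) ^ 2 / (a t) ^ 2 - κ / (a t) ^ 2))
      (𝓝[>] (0 : ℝ)) (𝓝 (-1 / ε)) := by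
  subst ha
  have hp : 0 ≤ 1 - 1 / ε := sub_nonneg.2 ((div_le_one (by linarith)).2 hε)
  have hL := tendsto_inv_log_nhdsGT_zero
  have hlim := ((hL.const_sub (-1 / ε)).sub (hL.pow 2)).sub
    (((tendsto_rpow_mul_inv_log_nhdsGT_zero hp).pow 2).const_mul κ)
  rw [show -1 / ε - 0 - 0 ^ 2 - κ * 0 ^ 2 = -1 / ε by ring] at hlim
  refine hlim.congr' ?_
  filter_upwards [Ioo_mem_nhdsGT (zero_lt_one' ℝ)] with t ht
  have ht0 : t ≠ 0 := ht.1.ne'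
  have hlog : Real.log t ≠ 0 := (Real.log_neg ht.1 ht.2).ne
  have hpow : t ^ (1 / ε) ≠ 0 := (Real.rpow_pos_of_pos ht.1 _).ne'
  rw [deriv_deriv_neg_rpow_mul_log _ ht.1, (hasDerivAt_neg_rpow_mul_log _ ht.1).deriv,
    Real.rpow_sub_one ht0, Real.rpow_sub ht.1, Real.rpow_one, neg_div]
  generalize t ^ (1 / ε) = x at *
  generalize 1 / ε = p at *
  generalize Real.log t = l at *
  field_simp
  ring
end

section
/- Let 0 < ε < 1, κ < 0, 0 < t₁ < 1, and let a(t) = −t^{1/ε}·log t. Then lim_{t→0⁺} ∫_t^{t₁} a(s) ∫_s^{t₁} (1/a(u))·(a''(u)/a(u) − a'(u)²/a(u)² − κ/a(u)²) du ds = +∞. -/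
open Filter Topology Set MeasureTheory intervalIntegral

/-- The integral over `[t, T]` as a function of its lower endpoint has derivative `-f t`. -/
lemma hasDerivAt_integral_lower {f : ℝ → ℝ} {b T t : ℝ} (hf : ContinuousOn f (Ioo 0 b))
    (hT : T ∈ Ioo 0 b) (ht : t ∈ Ioo 0 b) :
    HasDerivAt (fun t => ∫ u in t..T, f u) (-f t) t := by
  have hsub : uIcc t T ⊆ Ioo 0 b := ordConnected_Ioo.uIcc_subset ht hT
  exact integral_hasDerivAt_left (hf.mono hsub).intervalIntegrable
    (hf.stronglyMeasurableAtFilter isOpen_Ioo t ht) (hf.continuousAt (isOpen_Ioo.mem_nhds ht))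

/-- If `-F' ≤ f` near `0⁺`, then `∫ u in t..T, f u` dominates `F t` up to a constant. -/
lemma exists_sub_le_integral_of_neg_deriv_le {f F F' : ℝ → ℝ} {b T : ℝ}
    (hf : ContinuousOn f (Ioo 0 b)) (hT : T ∈ Ioo 0 b)
    (hF : ∀ᶠ u in 𝓝[>] (0 : ℝ), HasDerivAt F (F' u) u ∧ -F' u ≤ f u) :
    ∃ C, ∀ᶠ t in 𝓝[>] (0 : ℝ), F t - C ≤ ∫ u in t..T, f u := by
  have hb : ∀ᶠ u in 𝓝[>] (0 : ℝ), u ∈ Ioo 0 b :=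
    Ioo_mem_nhdsGT (hT.1.trans hT.2)
  obtain ⟨δ, hδ, hsub⟩ := (mem_nhdsGT_iff_exists_Ioc_subset).1 (hF.and hb)
  have hδ0 : (0 : ℝ) < δ := hδ
  have hder : ∀ t ∈ Ioc 0 δ,
      HasDerivAt (fun t => (∫ u in t..T, f u) - F t) (-f t - F' t) t := fun t ht =>
    (hasDerivAt_integral_lower hf hT (hsub ht).2).sub (hsub ht).1.1
  have hanti : AntitoneOn (fun t => (∫ u in t..T, f u) - F t) (Ioc 0 δ) := by
    refine antitoneOn_of_deriv_nonpos (convex_Ioc 0 δ)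
      (fun t ht => (hder t ht).continuousAt.continuousWithinAt) ?_ ?_ <;>
      rw [interior_Ioc]
    · exact fun t ht =>
        (hder t (Ioo_subset_Ioc_self ht)).differentiableAt.differentiableWithinAt
    · intro t ht
      rw [(hder t (Ioo_subset_Ioc_self ht)).deriv]
      linarith [(hsub (Ioo_subset_Ioc_self ht)).1.2]
  refine ⟨F δ - ∫ u in δ..T, f u, ?_⟩
  filter_upwards [Ioc_mem_nhdsGT hδ0] with t ht
  have := hanti ht (right_mem_Ioc.2 hδ0) ht.2
  simp only at this
  linarith

lemma hasDerivAt_rpow_mul_log_affine (q c d : ℝ) {u : ℝ} (hu : 0 < u) :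
    HasDerivAt (fun u => u ^ q * (c * Real.log u + d))
      (u ^ (q - 1) * (q * c * Real.log u + (q * d + c))) u := by
  have h1 := Real.hasDerivAt_rpow_const (p := q) (Or.inl hu.ne')
  have h2 := ((Real.hasDerivAt_log hu.ne').const_mul c).add_const d
  refine (h1.mul h2).congr_deriv ?_
  rw [Real.rpow_sub_one hu.ne']
  field_simp
  ring

/-- The scale factor `a(u) = -u ^ p * log u`. -/
noncomputable def logScale (p u : ℝ) : ℝ := -(u ^ p) * Real.log u

/-- The inner integrand of the double integral for the scale factor `a` and curvature `κ`. -/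
noncomputable def curvatureIntegrand (a : ℝ → ℝ) (κ u : ℝ) : ℝ :=
  (1 / a u) * (deriv (deriv a) u / a u - (deriv a u) ^ 2 / (a u) ^ 2 - κ / (a u) ^ 2)

lemma logScale_pos (p : ℝ) {u : ℝ} (hu : u ∈ Ioo (0 : ℝ) 1) : 0 < logScale p u := by
  have h1 := Real.rpow_pos_of_pos hu.1 p
  have h2 := Real.log_neg hu.1 hu.2
  unfold logScale
  nlinarith

lemma hasDerivAt_logScale (p : ℝ) {u : ℝ} (hu : 0 < u) :
    HasDerivAt (logScale p) (u ^ (p - 1) * (-p * Real.log u - 1)) u := by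
  convert hasDerivAt_rpow_mul_log_affine p (-1) 0 hu using 1
  · ext v
    simp [logScale]
  · ring

lemma deriv_deriv_logScale (p : ℝ) {u : ℝ} (hu : 0 < u) :
    deriv (deriv (logScale p)) u
      = u ^ (p - 1 - 1) * ((p - 1) * -p * Real.log u + ((p - 1) * -1 + -p)) := by
  have h : deriv (logScale p) =ᶠ[𝓝 u] fun v => v ^ (p - 1) * (-p * Real.log v + -1) := by
    filter_upwards [Ioi_mem_nhds hu] with v hv
    rw [(hasDerivAt_logScale p hv).deriv]
    ring
  rw [h.deriv_eq, (hasDerivAt_rpow_mul_log_affine (p - 1) (-p) (-1) hu).deriv]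

lemma curvatureIntegrand_logScale (p κ : ℝ) {u : ℝ} (hu : u ∈ Ioo (0 : ℝ) 1) :
    curvatureIntegrand (logScale p) κ u = (1 / logScale p u) *
      (-(p + 1 / Real.log u + 1 / Real.log u ^ 2) / u ^ 2 - κ / logScale p u ^ 2) := by
  have hX := (Real.rpow_pos_of_pos hu.1 p).ne'
  have hL := (Real.log_neg hu.1 hu.2).ne
  have hu0 := hu.1.ne'
  rw [curvatureIntegrand, deriv_deriv_logScale p hu.1, (hasDerivAt_logScale p hu.1).deriv,
    Real.rpow_sub_one hu0, Real.rpow_sub_one hu0]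
  congr 2
  unfold logScale
  field_simp
  ring

lemma continuousOn_logScale (p : ℝ) : ContinuousOn (logScale p) (Ioo 0 1) := fun _ hu =>
  (hasDerivAt_logScale p hu.1).continuousAt.continuousWithinAt

lemma continuousOn_curvatureIntegrand_logScale (p κ : ℝ) :
    ContinuousOn (curvatureIntegrand (logScale p) κ) (Ioo 0 1) := by
  refine ContinuousOn.congr ?_ fun u hu => curvatureIntegrand_logScale p κ hu
  have ha := continuousOn_logScale p
  have ha0 : ∀ u ∈ Ioo (0 : ℝ) 1, logScale p u ≠ 0 := fun u hu => (logScale_pos p hu).ne'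
  have hlog : ContinuousOn Real.log (Ioo 0 1) :=
    Real.continuousOn_log.mono fun u hu => hu.1.ne'
  have hlog0 : ∀ u ∈ Ioo (0 : ℝ) 1, Real.log u ≠ 0 := fun u hu => (Real.log_neg hu.1 hu.2).ne
  refine (continuousOn_const.div ha ha0).mul (.sub (.div (.neg (.add (.add continuousOn_const
    (continuousOn_const.div hlog hlog0)) (continuousOn_const.div (hlog.pow 2) ?_)))
    (continuousOn_id.pow 2) ?_) (continuousOn_const.div (ha.pow 2) ?_))
  · exact fun u hu => pow_ne_zero 2 (hlog0 u hu)
  · exact fun u hu => pow_ne_zero 2 hu.1.ne'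
  · exact fun u hu => pow_ne_zero 2 (ha0 u hu)

lemma tendsto_logScale_div_self {p : ℝ} (hp : 1 < p) :
    Tendsto (fun u => logScale p u / u) (𝓝[>] 0) (𝓝 0) := by
  have h := (tendsto_log_mul_rpow_nhdsGT_zero (sub_pos.2 hp)).neg
  rw [neg_zero] at h
  refine h.congr' ?_
  filter_upwards [self_mem_nhdsWithin] with u hu
  have hu0 : u ≠ 0 := (mem_Ioi.1 hu).ne'
  rw [Real.rpow_sub_one hu0, logScale]
  ring

/-- Near `0⁺` the curvature term dominates: the inner integrand exceeds `K / (a(u) u²)`. -/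
lemma eventually_le_curvatureIntegrand_logScale {p κ : ℝ} (hp : 1 < p) (hκ : κ < 0) (K : ℝ) :
    ∀ᶠ u in 𝓝[>] (0 : ℝ),
      K / (logScale p u * u ^ 2) ≤ curvatureIntegrand (logScale p) κ u := by
  have hlim : Tendsto (fun u => (p + 1 + K) * (logScale p u / u) ^ 2) (𝓝[>] 0) (𝓝 0) := by
    simpa using ((tendsto_logScale_div_self hp).pow 2).const_mul (p + 1 + K)
  filter_upwards [hlim.eventually_lt_const (neg_pos.2 hκ), Ioo_mem_nhdsGT zero_lt_one,
    Real.tendsto_log_nhdsGT_zero.eventually_le_atBot (-1)] with u h hu hL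
  rw [curvatureIntegrand_logScale p κ hu]
  have ha := logScale_pos p hu
  have hu0 := hu.1
  have h1 : 1 / Real.log u ≤ 0 := one_div_nonpos.2 (by linarith)
  have h2 : 1 / Real.log u ^ 2 ≤ 1 := by
    rw [div_le_one (by nlinarith)]
    nlinarith
  have h3 : (p + 1 + K) / u ^ 2 ≤ -κ / logScale p u ^ 2 := by
    rw [le_div_iff₀ (by positivity)]
    calc (p + 1 + K) / u ^ 2 * logScale p u ^ 2
        = (p + 1 + K) * (logScale p u / u) ^ 2 := by ring
      _ ≤ -κ := h.le
  have h4 : (K + (p + 1 / Real.log u + 1 / Real.log u ^ 2)) / u ^ 2 ≤ (p + 1 + K) / u ^ 2 :=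
    div_le_div_of_nonneg_right (by linarith) (by positivity)
  calc K / (logScale p u * u ^ 2) = (1 / logScale p u) * (K / u ^ 2) := by field_simp
    _ ≤ _ := by
      gcongr
      rw [add_div] at h4
      rw [neg_div] at h3 ⊢
      linarith

/-- The inner integral is at least `1 / (s a(s))` up to a constant. -/
lemma exists_sub_le_integral_curvatureIntegrand {p κ T : ℝ} (hp : 1 < p) (hκ : κ < 0)
    (hT : T ∈ Ioo (0 : ℝ) 1) :
    ∃ C, ∀ᶠ s in 𝓝[>] (0 : ℝ), 1 / (s * logScale p s) - C
      ≤ ∫ u in s..T, curvatureIntegrand (logScale p) κ u := by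
  refine exists_sub_le_integral_of_neg_deriv_le
    (F := fun s => 1 / (s * logScale p s))
    (F' := fun u => -(1 + p + 1 / Real.log u) / (logScale p u * u ^ 2))
    (continuousOn_curvatureIntegrand_logScale p κ) hT ?_
  filter_upwards [eventually_le_curvatureIntegrand_logScale hp hκ (1 + p),
    Ioo_mem_nhdsGT zero_lt_one] with u h hu
  have ha := logScale_pos p hu
  have hu0 := hu.1
  have hL := Real.log_neg hu.1 hu.2
  constructor
  · have hd := ((hasDerivAt_id u).mul (hasDerivAt_logScale p hu0)).inv
      (mul_pos hu0 ha).ne'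
    simp only [one_div]
    refine hd.congr_deriv ?_
    have hX := (Real.rpow_pos_of_pos hu0 p).ne'
    have hL' := hL.ne
    simp only [Pi.mul_apply, id_eq]
    rw [Real.rpow_sub_one hu0.ne']
    unfold logScale
    field_simp
    ring
  · refine le_trans ?_ h
    rw [← neg_div, neg_neg]
    exact div_le_div_of_nonneg_right (by linarith [one_div_nonpos.2 hL.le]) (by positivity)

lemma tendsto_integral_logScale_mul_integral {p κ T : ℝ} (hp : 1 < p) (hκ : κ < 0)
    (hT : T ∈ Ioo (0 : ℝ) 1) :
    Tendsto (fun t => ∫ s in t..T, logScale p s *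
      ∫ u in s..T, curvatureIntegrand (logScale p) κ u) (𝓝[>] 0) atTop := by
  obtain ⟨C, hC⟩ := exists_sub_le_integral_curvatureIntegrand hp hκ hT
  have hcont : ContinuousOn (fun s => logScale p s *
      ∫ u in s..T, curvatureIntegrand (logScale p) κ u) (Ioo 0 1) :=
    (continuousOn_logScale p).mul fun s hs => (hasDerivAt_integral_lower
      (continuousOn_curvatureIntegrand_logScale p κ) hT hs).continuousAt.continuousWithinAt
  obtain ⟨D, hD⟩ := exists_sub_le_integral_of_neg_deriv_le
    (F := fun s => -Real.log s + |C| * s) (F' := fun s => -s⁻¹ + |C| * 1) hcont hT (by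
      filter_upwards [hC, Ioo_mem_nhdsGT zero_lt_one,
        (tendsto_logScale_div_self hp).eventually_lt_const zero_lt_one] with s h hs hlt
      have ha := logScale_pos p hs
      have hs0 := hs.1
      refine ⟨(Real.hasDerivAt_log hs0.ne').neg.add ((hasDerivAt_id s).const_mul _), ?_⟩
      have ha1 : logScale p s ≤ 1 := by
        rw [div_lt_one hs0] at hlt
        linarith [hs.2]
      have h1 : logScale p s * (1 / (s * logScale p s) - C) = s⁻¹ - logScale p s * C := by
        field_simp
      have h2 : logScale p s * C ≤ |C| := by
        nlinarith [le_abs_self C, abs_nonneg C]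
      have h3 := mul_le_mul_of_nonneg_left h ha.le
      linarith)
  refine tendsto_atTop_mono' _ hD (tendsto_atTop_add_const_right _ (-D) ?_)
  refine tendsto_atTop_mono' _ ?_ (tendsto_neg_atBot_atTop.comp Real.tendsto_log_nhdsGT_zero)
  filter_upwards [self_mem_nhdsWithin] with s hs
  have := mul_nonneg (abs_nonneg C) (mem_Ioi.1 hs).le
  simp only [Function.comp_apply]
  linarith

/-- Paper's claim that for the logarithmically corrected scale factor
`a(t) = -t^(1/ε) * log t` with `0 < ε < 1` and negative spatial curvature
`κ < 0`, condition (33) of its main theorem fails: the double integral tends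
to `+∞`. -/
theorem log_corrected_condition33_fails
    (ε : ℝ) (hε0 : 0 < ε) (hε1 : ε < 1) (κ : ℝ) (hκ : κ < 0)
    (t₁ : ℝ) (ht₁0 : 0 < t₁) (ht₁1 : t₁ < 1)
    (a : ℝ → ℝ) (ha : a = fun u => -(u ^ (1 / ε)) * Real.log u) :
    Tendsto (fun t => ∫ s in t..t₁, a s * ∫ u in s..t₁,
        (1 / a u) * (deriv (deriv a) u / a u - (deriv a u) ^ 2 / (a u) ^ 2
          - κ / (a u) ^ 2))
      (𝓝[>] (0 : ℝ)) atTop := by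
  subst ha
  exact tendsto_integral_logScale_mul_integral ((one_lt_div hε0).2 hε1) hκ ⟨ht₁0, ht₁1⟩
end

section
/- Let t₂ > 0 and define h : (0,∞) → ℝ by h(t) = −2√t₂·(arcsinh(√t₂) − arcsinh(√t)). Then h is twice differentiable on (0,∞) and satisfies 2t(1+t)·h''(t) + (1+2t)·h'(t) = 0 for all t > 0, together with h(t₂) = 0 and h'(t₂) = 1/√(1+t₂). -/
open Filter Topology Set

/-- On the positive half-line, `arsinh ∘ √` has derivative `1 / (2 √(t (1 + t)))`. -/
theorem hasDerivAt_arsinh_sqrt {t : ℝ} (ht : 0 < t) :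
    HasDerivAt (fun x => Real.arsinh (Real.sqrt x)) (2 * Real.sqrt (t * (1 + t)))⁻¹ t := by
  refine (Real.hasDerivAt_sqrt ht.ne').arsinh.congr_deriv ?_
  rw [Real.sq_sqrt ht.le, Real.sqrt_mul ht.le, smul_eq_mul]
  simp only [mul_inv, one_div]
  ring

/-- Derivative of `1 / √(t (1 + t))` on the positive half-line. -/
theorem hasDerivAt_inv_sqrt_mul_one_add {t : ℝ} (ht : 0 < t) :
    HasDerivAt (fun x => (Real.sqrt (x * (1 + x)))⁻¹)
      (-(1 + 2 * t) / (2 * (t * (1 + t)) * Real.sqrt (t * (1 + t)))) t := by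
  have hq : 0 < t * (1 + t) := by positivity
  have hs : 0 < Real.sqrt (t * (1 + t)) := Real.sqrt_pos.mpr hq
  have hd : HasDerivAt (fun x : ℝ => x * (1 + x)) (1 + 2 * t) t := by
    refine ((hasDerivAt_id' t).fun_mul ((hasDerivAt_id' t).const_add 1)).congr_deriv ?_
    ring
  refine ((hd.sqrt hq.ne').fun_inv hs.ne').congr_deriv ?_
  rw [Real.sq_sqrt hq.le]
  field_simp

/-- Paper's explicit solution (Eq. 26) of the Jacobi equation (Eq. 22) for the
transverse components of a Jacobi field along a non-comoving timelike geodesic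
in the spatially flat radiation FLRW spacetime `a(t) = √t`. -/
theorem jacobi_field_explicit_solution
    (t₂ : ℝ) (ht₂ : 0 < t₂)
    (h : ℝ → ℝ)
    (hh : ∀ t, h t = -2 * Real.sqrt t₂ *
      (Real.arsinh (Real.sqrt t₂) - Real.arsinh (Real.sqrt t))) :
    (∀ t ∈ Ioi (0 : ℝ), DifferentiableAt ℝ h t) ∧
    (∀ t ∈ Ioi (0 : ℝ), DifferentiableAt ℝ (deriv h) t) ∧
    (∀ t ∈ Ioi (0 : ℝ),
      2 * t * (1 + t) * deriv (deriv h) t + (1 + 2 * t) * deriv h t = 0) ∧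
    h t₂ = 0 ∧
    deriv h t₂ = 1 / Real.sqrt (1 + t₂) := by
  have hfun : h = fun t => -2 * Real.sqrt t₂ *
      (Real.arsinh (Real.sqrt t₂) - Real.arsinh (Real.sqrt t)) := funext hh
  have first : ∀ t ∈ Ioi (0 : ℝ),
      HasDerivAt h (Real.sqrt t₂ * (Real.sqrt (t * (1 + t)))⁻¹) t := by
    intro t ht
    rw [hfun]
    refine (((hasDerivAt_arsinh_sqrt ht).const_sub (Real.arsinh (Real.sqrt t₂))).const_mul
      (-2 * Real.sqrt t₂)).congr_deriv ?_
    rw [mul_inv]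
    ring
  have second : ∀ t ∈ Ioi (0 : ℝ), HasDerivAt (deriv h) (Real.sqrt t₂ *
      (-(1 + 2 * t) / (2 * (t * (1 + t)) * Real.sqrt (t * (1 + t))))) t := by
    intro t ht
    refine ((hasDerivAt_inv_sqrt_mul_one_add ht).const_mul (Real.sqrt t₂)).congr_of_eventuallyEq ?_
    filter_upwards [isOpen_Ioi.mem_nhds ht] with x hx using (first x hx).deriv
  refine ⟨fun t ht => (first t ht).differentiableAt,
    fun t ht => (second t ht).differentiableAt, fun t ht => ?_, by simp [hh], ?_⟩
  · rw [(second t ht).deriv, (first t ht).deriv]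
    have ht' : 0 < t := ht
    have hs : 0 < Real.sqrt (t * (1 + t)) := Real.sqrt_pos.mpr (by positivity)
    field_simp
    ring
  · rw [(first t₂ ht₂).deriv, Real.sqrt_mul ht₂.le]
    have hs : 0 < Real.sqrt t₂ := Real.sqrt_pos.mpr ht₂
    field_simp
end
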